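/- arXiv:1404.3509 — 2 statements merged into one kernel-verified Lean document; each statement's English description precedes it below -/
import Mathlib

section
/- For every polynomial function f : ℝⁿ → ℝ, the set of critical values of f, namely {f(x) : x ∈ ℝⁿ, ∇f(x) = 0}, is finite. -/
theorem aux_lift {K : Type} [Field K] [Algebra ℝ K] [Algebra.EssFiniteType ℝ K] {t : K}
    (ht : Transcendental ℝ t) {B : Type} [CommRing B] [Algebra ℝ B] (g : B →ₐ[ℝ] K)
    (hg : Function.Surjective g) (hg' : IsNilpotent (RingHom.ker (g : B →+* K)))
    (b : B) (hb : g b = t) :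
    ∃ φ : K →ₐ[ℝ] B, (∀ x, g (φ x) = x) ∧ φ t = b := by
  letI : Algebra (Polynomial ℝ) K := (Polynomial.aeval (R := ℝ) t).toRingHom.toAlgebra
  letI : Algebra (Polynomial ℝ) B := (Polynomial.aeval (R := ℝ) b).toRingHom.toAlgebra
  have hK : ∀ p : Polynomial ℝ, algebraMap (Polynomial ℝ) K p = Polynomial.aeval t p :=
    fun _ => rfl
  have hB : ∀ p : Polynomial ℝ, algebraMap (Polynomial ℝ) B p = Polynomial.aeval b p :=
    fun _ => rfl
  haveI : IsScalarTower ℝ (Polynomial ℝ) K := .of_algebraMap_eq fun x => by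
    rw [hK, Polynomial.algebraMap_eq, Polynomial.aeval_C]
  haveI : IsScalarTower ℝ (Polynomial ℝ) B := .of_algebraMap_eq fun x => by
    rw [hB, Polynomial.algebraMap_eq, Polynomial.aeval_C]
  haveI : FaithfulSMul (Polynomial ℝ) K := by
    rw [faithfulSMul_iff_algebraMap_injective]
    exact transcendental_iff_injective.mp ht
  letI : Algebra (FractionRing (Polynomial ℝ)) K := FractionRing.liftAlgebra _ _
  haveI : IsScalarTower (Polynomial ℝ) (FractionRing (Polynomial ℝ)) K :=
    FractionRing.isScalarTower_liftAlgebra _ _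
  haveI : Algebra.EssFiniteType (Polynomial ℝ) K := .of_comp ℝ _ _
  haveI : Algebra.EssFiniteType (FractionRing (Polynomial ℝ)) K := .of_comp (Polynomial ℝ) _ _
  haveI : CharZero (FractionRing (Polynomial ℝ)) :=
    charZero_of_injective_algebraMap
      (IsFractionRing.injective (Polynomial ℝ) (FractionRing (Polynomial ℝ)))
  haveI : Algebra.FormallySmooth (FractionRing (Polynomial ℝ)) K :=
    Algebra.FormallySmooth.of_perfectField
  haveI : Algebra.FormallySmooth (Polynomial ℝ) (FractionRing (Polynomial ℝ)) :=
    .of_isLocalization (nonZeroDivisors (Polynomial ℝ))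
  haveI : Algebra.FormallySmooth (Polynomial ℝ) K :=
    .comp _ (FractionRing (Polynomial ℝ)) _
  let g' : B →ₐ[Polynomial ℝ] K :=
    { (g : B →+* K) with
      commutes' := fun p => by
        change g (algebraMap (Polynomial ℝ) B p) = _
        rw [hB, hK, ← hb, ← Polynomial.aeval_algHom_apply] }
  let φ := Algebra.FormallySmooth.liftOfSurjective (AlgHom.id (Polynomial ℝ) K) g' hg hg'
  refine ⟨φ.restrictScalars ℝ, fun x => ?_, ?_⟩
  · exact Algebra.FormallySmooth.liftOfSurjective_apply (AlgHom.id (Polynomial ℝ) K) g' hg hg' x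
  · have := φ.commutes Polynomial.X
    rw [hB, hK, Polynomial.aeval_X, Polynomial.aeval_X] at this
    exact this

theorem aux_alg {K : Type} [Field K] [Algebra ℝ K] [Algebra.EssFiniteType ℝ K] {n : ℕ}
    (π : MvPolynomial (Fin n) ℝ →ₐ[ℝ] K) (P : MvPolynomial (Fin n) ℝ)
    (h : ∀ i, π (MvPolynomial.pderiv i P) = 0) : IsAlgebraic ℝ (π P) := by
  by_contra ht
  obtain ⟨φ, h1, h2⟩ := aux_lift (K := K) ht (TrivSqZeroExt.fstHom ℝ K K)
    (fun x => ⟨TrivSqZeroExt.inl x, rfl⟩)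
    ⟨2, by
      rw [pow_two, Ideal.zero_eq_bot, eq_bot_iff, Ideal.mul_le]
      intro x hx y hy
      have hx' : x.fst = 0 := hx
      have hy' : y.fst = 0 := hy
      rw [Ideal.mem_bot]
      ext <;> simp [hx', hy']⟩
    (TrivSqZeroExt.inl (π P) + TrivSqZeroExt.inr 1) (by simp)
  have h1' : ∀ x, (φ x).fst = x := h1
  have key : ∀ Q : MvPolynomial (Fin n) ℝ, (φ (π Q)).snd =
      ∑ i, π (MvPolynomial.pderiv i Q) * (φ (π (MvPolynomial.X i))).snd := by
    intro Q
    induction Q using MvPolynomial.induction_on with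
    | C a =>
      have : (MvPolynomial.C a : MvPolynomial (Fin n) ℝ) = algebraMap ℝ _ a := rfl
      simp only [MvPolynomial.pderiv_C, map_zero, zero_mul, Finset.sum_const_zero]
      rw [this, AlgHom.commutes, AlgHom.commutes]
      rfl
    | add p q hp hq => simp [hp, hq, add_mul, Finset.sum_add_distrib]
    | mul_X p j hp =>
      simp only [map_mul, TrivSqZeroExt.snd_mul, h1', hp, Derivation.leibniz, map_add,
        smul_eq_mul, add_mul, Finset.sum_add_distrib, MvPolynomial.pderiv_X, MulOpposite.smul_eq_mul_unop,
        MulOpposite.unop_op]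
      congr 1
      · rw [Finset.sum_eq_single j]
        · simp
        · intro i _ hij
          simp [Pi.single_apply, hij.symm]
        · simp
      · rw [Finset.sum_mul]
        exact Finset.sum_congr rfl fun i _ => by ring
  have := key P
  rw [h2] at this
  simp [h] at this

/-- For every polynomial function `f : ℝⁿ → ℝ`, the set of critical
values of `f` (the values of `f` at points where the gradient vanishes) is finite. -/
theorem statement9 {n : ℕ} (P : MvPolynomial (Fin n) ℝ) :
    {y : ℝ | ∃ x : Fin n → ℝ,
      (∀ i : Fin n, MvPolynomial.eval x (MvPolynomial.pderiv i P) = 0) ∧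
      MvPolynomial.eval x P = y}.Finite := by
  let I : Ideal (MvPolynomial (Fin n) ℝ) :=
    Ideal.span (Set.range fun i => MvPolynomial.pderiv i P)
  have hfin := I.finite_minimalPrimes_of_isNoetherianRing
  have hq : ∀ p ∈ I.minimalPrimes, ∃ q : Polynomial ℝ, q ≠ 0 ∧ Polynomial.aeval P q ∈ p := by
    intro p hp
    haveI : p.IsPrime := hp.1.1
    let A := MvPolynomial (Fin n) ℝ ⧸ p
    let π : MvPolynomial (Fin n) ℝ →ₐ[ℝ] FractionRing A :=
      (IsScalarTower.toAlgHom ℝ A (FractionRing A)).comp (Ideal.Quotient.mkₐ ℝ p)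
    have hπ : ∀ Q, π Q = 0 ↔ Q ∈ p := by
      intro Q
      change algebraMap A (FractionRing A) (Ideal.Quotient.mk p Q) = 0 ↔ _
      rw [map_eq_zero_iff _ (IsFractionRing.injective A (FractionRing A)),
        Ideal.Quotient.eq_zero_iff_mem]
    obtain ⟨q, hq0, hq⟩ := aux_alg π P fun i =>
      (hπ _).2 (hp.1.2 (Ideal.subset_span ⟨i, rfl⟩))
    refine ⟨q, hq0, (hπ _).1 ?_⟩
    rw [← Polynomial.aeval_algHom_apply, hq]
  choose! q hq0 hqm using hq
  refine (hfin.biUnion fun p hp => Polynomial.rootSet_finite (q p) ℝ).subset ?_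
  rintro y ⟨x, hx, rfl⟩
  have hle : I ≤ RingHom.ker (MvPolynomial.eval x) := by
    rw [Ideal.span_le]
    rintro _ ⟨i, rfl⟩
    exact hx i
  haveI : (RingHom.ker (MvPolynomial.eval x)).IsPrime := RingHom.ker_isPrime _
  obtain ⟨p, hp, hpx⟩ := Ideal.exists_minimalPrimes_le hle
  refine Set.mem_biUnion hp ?_
  rw [Polynomial.mem_rootSet]
  refine ⟨hq0 p hp, ?_⟩
  have h := hpx (hqm p hp)
  rw [RingHom.mem_ker, ← MvPolynomial.coe_aeval_eq_eval] at h
  rw [← MvPolynomial.coe_aeval_eq_eval]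
  have h' : MvPolynomial.aeval x (Polynomial.aeval P (q p)) = 0 := h
  rw [← Polynomial.aeval_algHom_apply] at h'
  exact h'
end

section
/- Let f and g be continuous semialgebraic functions defined on a common neighbourhood of 0 in ℝⁿ with f(0) = g(0) = 0. If 𝒻_f = 𝒻_g, then F_f(r,a) = F_g(r,a) (as sets) for 0 < a ≪ r ≪ 1. -/
noncomputable section
open Classical Filter Topology

namespace RealMilnor

/-- Semialgebraic subsets of `ℝ^ι`: the Boolean algebra generated by the sets
`{x | P(x) > 0}` for real polynomials `P`. -/
inductive IsRSA (ι : Type) : Set (ι → ℝ) → Prop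
  | basic (P : MvPolynomial ι ℝ) : IsRSA ι {x | 0 < MvPolynomial.eval x P}
  | compl {s : Set (ι → ℝ)} : IsRSA ι s → IsRSA ι sᶜ
  | union {s t : Set (ι → ℝ)} : IsRSA ι s → IsRSA ι t → IsRSA ι (s ∪ t)

/-- The Euclidean norm on `ℝⁿ`. -/
def enorm {n : ℕ} (x : Fin n → ℝ) : ℝ := Real.sqrt (∑ i, x i ^ 2)

/-- An arc in `ℝⁿ`: (a representative of) the germ at `0⁺` of a continuous
semialgebraic map `(0,ε) → ℝⁿ`. -/
def IsArc {n : ℕ} (γ : ℝ → (Fin n → ℝ)) : Prop :=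
  ∃ ε : ℝ, 0 < ε ∧ ContinuousOn γ (Set.Ioo 0 ε) ∧
    IsRSA (Option (Fin n))
      {z | z none ∈ Set.Ioo 0 ε ∧ (fun i => z (some i)) = γ (z none)}

/-- The set `𝒻_f` of arcs `γ` with `lim_{t→0⁺} γ(t) = 0` and `f(γ(t)) = t` for all
sufficiently small `t > 0`. -/
def ArcFib {n : ℕ} (f : (Fin n → ℝ) → ℝ) : Set (ℝ → (Fin n → ℝ)) :=
  {γ | IsArc γ ∧ Filter.Tendsto γ (nhdsWithin 0 (Set.Ioi 0)) (nhds 0) ∧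
       ∀ᶠ t in nhdsWithin (0 : ℝ) (Set.Ioi 0), f (γ t) = t}

/-- The positive Milnor fibre `F_f(r,a) = {x ∈ ℝⁿ : |x| ≤ r, f(x) = a}`. -/
def Fib {n : ℕ} (f : (Fin n → ℝ) → ℝ) (r a : ℝ) : Set (Fin n → ℝ) :=
  {x | enorm x ≤ r ∧ f x = a}

/-- The graph of the restriction of `f : ℝⁿ → ℝ` to `A`. -/
def graphFunOn {n : ℕ} (f : (Fin n → ℝ) → ℝ) (A : Set (Fin n → ℝ)) :
    Set (Option (Fin n) → ℝ) :=
  {z | (fun i => z (some i)) ∈ A ∧ z none = f (fun i => z (some i))}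

/-- The graph of the restriction of `φ : ℝⁿ → ℝᵐ` to `A`. -/
def graphMapOn {n m : ℕ} (φ : (Fin n → ℝ) → (Fin m → ℝ)) (A : Set (Fin n → ℝ)) :
    Set (Fin n ⊕ Fin m → ℝ) :=
  {z | (fun i => z (Sum.inl i)) ∈ A ∧
       (fun j => z (Sum.inr j)) = φ (fun i => z (Sum.inl i))}

/-- `A` and `B` are semialgebraically homeomorphic: there is a semialgebraic
bijection between them, continuous with continuous inverse. -/
def IsSemialgHomeo {n : ℕ} (A B : Set (Fin n → ℝ)) : Prop :=
  ∃ φ ψ : (Fin n → ℝ) → (Fin n → ℝ),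
    Set.MapsTo φ A B ∧ Set.MapsTo ψ B A ∧
    (∀ x ∈ A, ψ (φ x) = x) ∧ (∀ y ∈ B, φ (ψ y) = y) ∧
    ContinuousOn φ A ∧ ContinuousOn ψ B ∧
    IsRSA (Fin n ⊕ Fin n) (graphMapOn φ A) ∧ IsRSA (Fin n ⊕ Fin n) (graphMapOn ψ B)


section TS
variable {ι : Type}

/-- definable predicates -/
def Df (P : (ι → ℝ) → Prop) : Prop := IsRSA ι {x | P x}

theorem Df.congr {P Q : (ι → ℝ) → Prop} (h : Df P) (e : ∀ x, P x ↔ Q x) : Df Q := by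
  have : P = Q := funext fun x => propext (e x)
  exact this ▸ h

theorem Df.not {P : (ι → ℝ) → Prop} (h : Df P) : Df (fun x => ¬ P x) := IsRSA.compl h
theorem Df.or {P Q : (ι → ℝ) → Prop} (h : Df P) (h' : Df Q) : Df (fun x => P x ∨ Q x) :=
  IsRSA.union h h'
theorem Df.and {P Q : (ι → ℝ) → Prop} (h : Df P) (h' : Df Q) : Df (fun x => P x ∧ Q x) :=
  (h.not.or h'.not).not.congr fun x => by tauto
theorem Df.imp {P Q : (ι → ℝ) → Prop} (h : Df P) (h' : Df Q) : Df (fun x => P x → Q x) :=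
  (h.not.or h').congr fun x => by tauto
theorem Df.tru : Df (fun _ : ι → ℝ => True) :=
  (show Df _ from IsRSA.basic (1 : MvPolynomial ι ℝ)).congr fun x => by simp
theorem Df.const (p : Prop) : Df (fun _ : ι → ℝ => p) := by
  by_cases h : p
  · exact Df.tru.congr fun x => by simp [h]
  · exact Df.tru.not.congr fun x => by simp [h]
theorem Df.exMem {α : Type*} {P : α → (ι → ℝ) → Prop} (L : List α) (h : ∀ a ∈ L, Df (P a)) :
    Df (fun x => ∃ a ∈ L, P a x) := by
  induction L with
  | nil => exact (Df.const False).congr fun x => by simp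
  | cons a L ih =>
    exact ((h a (by simp)).or (ih fun b hb => h b (by simp [hb]))).congr fun x => by simp
theorem Df.allMem {α : Type*} {P : α → (ι → ℝ) → Prop} (L : List α) (h : ∀ a ∈ L, Df (P a)) :
    Df (fun x => ∀ a ∈ L, P a x) :=
  (Df.exMem L (P := fun a x => ¬ P a x) fun a ha => (h a ha).not).not.congr fun x => by simp

abbrev Alg (ι : Type) := Subalgebra ℝ ((ι → ℝ) → ℝ)

def Good (R : Alg ι) : Prop := ∀ r ∈ R, Df (fun x => 0 < r x)

def polyAlg (ι : Type) : Alg ι :=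
  (MvPolynomial.aeval (R := ℝ) (fun i => fun x : ι → ℝ => x i)).range

theorem aeval_coord (p : MvPolynomial ι ℝ) (x : ι → ℝ) :
    (MvPolynomial.aeval (R := ℝ) (fun i => fun x : ι → ℝ => x i) p) x = MvPolynomial.eval x p := by
  induction p using MvPolynomial.induction_on with
  | C a => simp
  | add p q hp hq => simp [hp, hq]
  | mul_X p i hp => simp [hp]

theorem good_polyAlg : Good (polyAlg ι) := by
  rintro r ⟨p, rfl⟩
  exact (show Df _ from IsRSA.basic p).congr fun x => by
    rw [← aeval_coord]; rfl

structure MaxR (R : Alg ι) : Prop where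
  poly : polyAlg ι ≤ R
  good : Good R
  max : ∀ R', Good R' → R ≤ R' → R' ≤ R

theorem exists_maxR : ∃ R : Alg ι, MaxR R := by
  obtain ⟨m, hm, hM⟩ := zorn_le_nonempty₀ {R : Alg ι | Good R} (by
    intro c hc hch y hy
    refine ⟨sSup c, ?_, fun z hz => le_sSup hz⟩
    intro r hr
    have : Nonempty c := ⟨⟨y, hy⟩⟩
    rw [sSup_eq_iSup', ← SetLike.mem_coe, Subalgebra.coe_iSup_of_directed hch.directed] at hr
    obtain ⟨i, hi⟩ := Set.mem_iUnion.1 hr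
    exact hc i.2 r hi) (polyAlg ι) good_polyAlg
  exact ⟨m, hm, hM.1, fun R' h h' => hM.2 h h'⟩

open Polynomial

/-- evaluation of a polynomial with coefficients in `R` -/
def evR (R : Alg ι) (x : ι → ℝ) : R →+* ℝ := (Pi.evalRingHom _ x).comp R.val.toRingHom

@[simp] theorem evR_apply (R : Alg ι) (x : ι → ℝ) (r : R) : evR R x r = (r : (ι → ℝ) → ℝ) x := rfl

theorem aeval_ev (R : Alg ι) (p : R[X]) (h : (ι → ℝ) → ℝ) (x : ι → ℝ) :
    (aeval h p) x = (p.map (evR R x)).eval (h x) := by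
  induction p using Polynomial.induction_on' with
  | add p q hp hq => simp [hp, hq]
  | monomial n a => simp [Polynomial.map_monomial]

namespace MaxR
variable {R : Alg ι} (hR : MaxR R)
include hR

theorem mem_of_good (h : (ι → ℝ) → ℝ)
    (H : ∀ p : R[X], Df (fun x => 0 < (p.map (evR R x)).eval (h x))) : h ∈ R := by
  have key := hR.max ((aeval (R := R) h).range.restrictScalars ℝ) (by
      rintro r ⟨p, rfl⟩
      exact (H p).congr fun x => by rw [← aeval_ev]; rfl) (by
      intro r hr
      exact ⟨C ⟨r, hr⟩, by simp⟩)
  exact key ⟨X, by simp⟩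

omit hR in
theorem eval_mem (p : R[X]) {h : (ι → ℝ) → ℝ} (hh : h ∈ R) :
    (fun x => (p.map (evR R x)).eval (h x)) ∈ R := by
  have : (fun x => (p.map (evR R x)).eval (h x)) = ((p.eval ⟨h, hh⟩ : R) : (ι → ℝ) → ℝ) := by
    funext x
    have := Polynomial.eval_map_apply (evR R x) (p := p) (x := (⟨h, hh⟩ : R))
    rw [evR_apply, evR_apply] at this
    exact this
  rw [this]; exact Subtype.coe_prop _

theorem pos {r : (ι → ℝ) → ℝ} (h : r ∈ R) : Df (fun x => 0 < r x) := hR.good r h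
theorem lt {r s : (ι → ℝ) → ℝ} (h : r ∈ R) (h' : s ∈ R) : Df (fun x => r x < s x) :=
  (hR.pos (R.sub_mem h' h)).congr fun x => by simp
theorem le {r s : (ι → ℝ) → ℝ} (h : r ∈ R) (h' : s ∈ R) : Df (fun x => r x ≤ s x) :=
  (hR.lt h' h).not.congr fun x => by simp
theorem eq {r s : (ι → ℝ) → ℝ} (h : r ∈ R) (h' : s ∈ R) : Df (fun x => r x = s x) :=
  ((hR.le h h').and (hR.le h' h)).congr fun x => by simp [le_antisymm_iff]

omit hR in
theorem const (c : ℝ) : (fun _ => c) ∈ R := R.algebraMap_mem c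

theorem inv_mem {r : (ι → ℝ) → ℝ} (h : r ∈ R) : (fun x => (r x)⁻¹) ∈ R := by
  apply hR.mem_of_good
  intro p
  have h1 : ∀ p : R[X], ∃ s ∈ R, ∃ N : ℕ, ∀ x, r x ≠ 0 →
      s x = (p.map (evR R x)).eval (r x)⁻¹ * r x ^ N := by
    intro p
    induction p using Polynomial.induction_on' with
    | add p q hp hq =>
      obtain ⟨s, hs, N, h1⟩ := hp
      obtain ⟨t, ht, M, h2⟩ := hq
      refine ⟨s * r ^ M + t * r ^ N, R.add_mem (R.mul_mem hs (R.pow_mem h _))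
        (R.mul_mem ht (R.pow_mem h _)), N + M, fun x hx => ?_⟩
      simp [h1 x hx, h2 x hx]; ring
    | monomial n a =>
      refine ⟨a, a.2, n, fun x hx => ?_⟩
      simp [Polynomial.map_monomial]
      field_simp
  obtain ⟨s, hs, N, h1⟩ := h1 p
  refine (((hR.eq h (const 0)).and (hR.pos (eval_mem p (const 0)))).or
    ((hR.eq h (const 0)).not.and (hR.pos (R.mul_mem hs (R.pow_mem h N))))).congr fun x => ?_
  by_cases hx : r x = 0
  · simp [hx]
  · have : 0 < (r x ^ N) * (r x ^ N) := mul_self_pos.2 (pow_ne_zero _ hx)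
    simp only [hx, false_and, not_false_eq_true, true_and, false_or, Pi.mul_apply, Pi.pow_apply, h1 x hx]
    rw [mul_assoc, mul_pos_iff_of_pos_right this]

omit hR in
theorem neg_mul_of_injOn {p : ℝ[X]} {a b u : ℝ} (hinj : Set.InjOn (fun y => p.eval y) (Set.Icc a b))
    (hu : u ∈ Set.Icc a b) (h0 : p.eval u = 0) : p.eval a * p.eval b ≤ 0 := by
  have hab : a ≤ b := hu.1.trans hu.2
  rcases ContinuousOn.strictMonoOn_of_injOn_Icc' hab p.continuous.continuousOn hinj with h | h
  · have h1 := h.monotoneOn (Set.left_mem_Icc.2 hab) hu hu.1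
    have h2 := h.monotoneOn hu (Set.right_mem_Icc.2 hab) hu.2
    simp only [h0] at h1 h2
    exact mul_nonpos_of_nonpos_of_nonneg h1 h2
  · have h1 := h.antitoneOn (Set.left_mem_Icc.2 hab) hu hu.1
    have h2 := h.antitoneOn hu (Set.right_mem_Icc.2 hab) hu.2
    simp only [h0] at h1 h2
    exact mul_nonpos_of_nonneg_of_nonpos h1 h2

omit hR in
theorem exists_root_Icc {p : ℝ[X]} {a b : ℝ} (hab : a ≤ b) (h : p.eval a * p.eval b ≤ 0) :
    ∃ y ∈ Set.Icc a b, p.eval y = 0 := by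
  rcases mul_nonpos_iff.1 h with ⟨h1, h2⟩ | ⟨h1, h2⟩
  · exact intermediate_value_Icc' hab p.continuous.continuousOn ⟨h2, h1⟩
  · exact intermediate_value_Icc hab p.continuous.continuousOn ⟨h1, h2⟩

omit hR in
theorem injOn_of_deriv {p : ℝ[X]} {a b : ℝ} (h : ∀ z, a < z → z < b → p.derivative.eval z ≠ 0) :
    Set.InjOn (fun y => p.eval y) (Set.Icc a b) := by
  have key : ∀ u v, a ≤ u → v ≤ b → u < v → p.eval u ≠ p.eval v := by
    intro u v hu hv huv he
    obtain ⟨z, hz, hz'⟩ := exists_hasDerivAt_eq_zero (f := fun y => p.eval y) huv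
      p.continuous.continuousOn he (fun x _ => p.hasDerivAt x)
    exact h z (hu.trans_lt hz.1) (hz.2.trans_le hv) hz'
  intro u hu v hv he
  rcases lt_trichotomy u v with h | h | h
  · exact absurd he (key u v hu.1 hv.2 h)
  · exact h
  · exact absurd he.symm (key v u hv.1 hu.2 h)

/-- same position with respect to a list -/
def SamePos (E : List ((ι → ℝ) → ℝ)) (x : ι → ℝ) (y τ : ℝ) : Prop :=
  ∀ e ∈ E, (y ≤ e x ↔ τ ≤ e x) ∧ (y = e x ↔ τ = e x)

omit hR in
theorem SamePos.symm {E : List ((ι → ℝ) → ℝ)} {x : ι → ℝ} {y τ : ℝ} (h : SamePos E x y τ) :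
    SamePos E x τ y := fun e he => ⟨(h e he).1.symm, (h e he).2.symm⟩

omit hR in
theorem SamePos.sign {E : List ((ι → ℝ) → ℝ)} {x : ι → ℝ} {q : ℝ[X]}
    (hE : q ≠ 0 → ∀ y, q.eval y = 0 → ∃ e ∈ E, e x = y) {y τ : ℝ} (h : SamePos E x y τ) :
    0 < q.eval y ↔ 0 < q.eval τ := by
  by_cases hq : q = 0
  · simp [hq]
  have key : ∀ y τ, SamePos E x y τ → y < τ → 0 < q.eval y * q.eval τ := by
    intro y τ h hlt
    by_contra hc
    obtain ⟨z, hz, hz0⟩ := exists_root_Icc hlt.le (not_lt.1 hc)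
    obtain ⟨e, he, rfl⟩ := hE hq z hz0
    have h1 := (h e he).1.1 hz.1
    have h2 := (h e he).2.2 (le_antisymm h1 hz.2)
    have h3 := hz.2
    linarith
  rcases lt_trichotomy y τ with hl | hl | hl
  · exact pos_iff_pos_of_mul_pos (key y τ h hl)
  · rw [hl]
  · exact (pos_iff_pos_of_mul_pos (key τ y h.symm hl)).symm

def tests (E : List ((ι → ℝ) → ℝ)) : List ((ι → ℝ) → ℝ) :=
  (0 : (ι → ℝ) → ℝ) :: (E ++ (E.map (fun e => e + fun _ => 1) ++ (E.map (fun e => e - fun _ => 1) ++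
    E.flatMap (fun a => E.map (fun b => (a + b) * fun _ => 1/2)))))

omit hR in
theorem tests_mem {E : List ((ι → ℝ) → ℝ)} (hE : ∀ e ∈ E, e ∈ R) : ∀ e ∈ tests E, e ∈ R := by
  intro e he
  simp only [tests, List.mem_cons, List.mem_append, List.mem_map, List.mem_flatMap] at he
  rcases he with rfl | h | ⟨a, ha, rfl⟩ | ⟨a, ha, rfl⟩ | ⟨a, ha, b, hb, rfl⟩
  · exact R.zero_mem
  · exact hE e h
  · exact R.add_mem (hE a ha) (const 1)
  · exact R.sub_mem (hE a ha) (const 1)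
  · exact R.mul_mem (R.add_mem (hE a ha) (hE b hb)) (const _)

omit hR in
theorem exists_max_list (E : List ((ι → ℝ) → ℝ)) (x : ι → ℝ) (P : ℝ → Prop) :
    (∀ e ∈ E, ¬ P (e x)) ∨ ∃ a ∈ E, P (a x) ∧ ∀ e ∈ E, P (e x) → e x ≤ a x := by
  by_cases h : ∃ e ∈ E, P (e x)
  · right
    obtain ⟨e, he, hP⟩ := h
    obtain ⟨a, ha, hm⟩ := Finset.exists_max_image (E.toFinset.filter fun e => P (e x)) (fun e => e x)
      ⟨e, by simp [he, hP]⟩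
    simp only [Finset.mem_filter, List.mem_toFinset] at ha hm
    exact ⟨a, ha.1, ha.2, fun e he hp => hm e ⟨he, hp⟩⟩
  · left; push Not at h; exact h

omit hR in
theorem exists_min_list (E : List ((ι → ℝ) → ℝ)) (x : ι → ℝ) (P : ℝ → Prop) :
    (∀ e ∈ E, ¬ P (e x)) ∨ ∃ a ∈ E, P (a x) ∧ ∀ e ∈ E, P (e x) → a x ≤ e x := by
  by_cases h : ∃ e ∈ E, P (e x)
  · right
    obtain ⟨e, he, hP⟩ := h
    obtain ⟨a, ha, hm⟩ := Finset.exists_min_image (E.toFinset.filter fun e => P (e x)) (fun e => e x)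
      ⟨e, by simp [he, hP]⟩
    simp only [Finset.mem_filter, List.mem_toFinset] at ha hm
    exact ⟨a, ha.1, ha.2, fun e he hp => hm e ⟨he, hp⟩⟩
  · left; push Not at h; exact h

omit hR in
theorem exists_test (E : List ((ι → ℝ) → ℝ)) (x : ι → ℝ) (y : ℝ) :
    ∃ τ ∈ tests E, SamePos E x y (τ x) := by
  simp only [tests, List.mem_cons, List.mem_append, List.mem_map, List.mem_flatMap]
  by_cases hy : ∃ e ∈ E, e x = y
  · obtain ⟨e, he, rfl⟩ := hy
    exact ⟨e, by simp [he], fun e' _ => by simp⟩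
  push Not at hy
  have fin : ∀ τ : ℝ, (∀ e ∈ E, (y < e x → τ < e x) ∧ (e x < y → e x < τ)) → SamePos E x y τ := by
    intro τ h e he
    have h1 := h e he
    rcases lt_or_gt_of_ne (hy e he) with h | h
    · have := h1.2 h
      constructor <;> constructor <;> intro <;> linarith
    · have := h1.1 h
      constructor <;> constructor <;> intro <;> linarith
  rcases exists_max_list E x (· < y) with h | ⟨a, ha, hay, ham⟩ <;>
  rcases exists_min_list E x (y < ·) with h' | ⟨b, hb, hby, hbm⟩
  · refine ⟨0, by simp, fin _ fun e he => ⟨fun h1 => absurd h1 (h' e he), fun h1 => absurd h1 (h e he)⟩⟩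
  · refine ⟨_, Or.inr (Or.inr (Or.inr (Or.inl ⟨b, hb, rfl⟩))), fin _ fun e he =>
      ⟨fun h1 => ?_, fun h1 => absurd h1 (h e he)⟩⟩
    have := hbm e he h1
    simp; linarith
  · refine ⟨_, Or.inr (Or.inr (Or.inl ⟨a, ha, rfl⟩)), fin _ fun e he =>
      ⟨fun h1 => absurd h1 (h' e he), fun h1 => ?_⟩⟩
    have := ham e he h1
    simp; linarith
  · refine ⟨_, Or.inr (Or.inr (Or.inr (Or.inr ⟨a, ha, b, hb, rfl⟩))), fin _ fun e he =>
      ⟨fun h1 => ?_, fun h1 => ?_⟩⟩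
    · have := hbm e he h1
      simp; linarith
    · have := ham e he h1
      simp; linarith

/-- `E` covers the roots of `f` -/
def Cover (R : Alg ι) (f : R[X]) (E : List ((ι → ℝ) → ℝ)) : Prop :=
  (∀ e ∈ E, e ∈ R) ∧ ∀ x, f.map (evR R x) ≠ 0 → ∀ y, (f.map (evR R x)).eval y = 0 → ∃ e ∈ E, e x = y

/-- membership criterion for a root of a monic polynomial -/
theorem root_mem {f : R[X]} (hf : f.Monic) (hd : 0 < f.natDegree)
    (IH : ∀ q : R[X], q.natDegree < f.natDegree → ∃ E, Cover R q E)
    (B : (ι → ℝ) → Prop) (hB : Df B)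
    (ξ : (ι → ℝ) → ℝ) (h0 : ∀ x, ¬ B x → ξ x = 0)
    (h1 : ∀ x, B x → (f.map (evR R x)).eval (ξ x) = 0)
    (hle : ∀ e ∈ R, Df (fun x => B x ∧ ξ x ≤ e x))
    (heq : ∀ e ∈ R, Df (fun x => B x ∧ ξ x = e x)) : ξ ∈ R := by
  apply hR.mem_of_good
  intro q
  obtain ⟨E, hE, hE'⟩ := IH (q %ₘ f) (natDegree_modByMonic_lt _ hf (by
    rintro rfl; simp at hd))
  have hmod : ∀ x, B x → (q.map (evR R x)).eval (ξ x) = ((q %ₘ f).map (evR R x)).eval (ξ x) := by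
    intro x hx
    conv_lhs => rw [← modByMonic_add_div q f]
    simp [h1 x hx]
  have hsp : ∀ τ ∈ R, Df (fun x => B x ∧ SamePos E x (ξ x) (τ x)) := by
    intro τ hτ
    refine (hB.and (Df.allMem E (P := fun e x => ((B x ∧ ξ x ≤ e x) ↔ (τ x ≤ e x)) ∧ 
      ((B x ∧ ξ x = e x) ↔ τ x = e x)) ?_)).congr ?_
    · intro e he
      have a1 := hle e (hE e he)
      have a2 := heq e (hE e he)
      have a3 := hR.le hτ (hE e he)
      have a4 := hR.eq hτ (hE e he)
      exact (((a1.imp a3).and (a3.imp a1)).and ((a2.imp a4).and (a4.imp a2))).congr fun x => by tauto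
    · intro x
      unfold SamePos
      constructor
      · rintro ⟨hb, h⟩; exact ⟨hb, fun e he => by simpa [hb] using h e he⟩
      · rintro ⟨hb, h⟩; exact ⟨hb, fun e he => by simpa [hb] using h e he⟩
  refine ((hB.not.and (hR.pos (eval_mem q (const 0)))).or
    (Df.exMem (tests E) (P := fun τ x => (B x ∧ SamePos E x (ξ x) (τ x)) ∧
      0 < ((q %ₘ f).map (evR R x)).eval (τ x)) fun τ hτ => (hsp τ (tests_mem hE τ hτ)).and
        (hR.pos (eval_mem _ (tests_mem hE τ hτ))))).congr ?_
  intro x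
  by_cases hx : B x
  · simp only [hx, not_true_eq_false, false_and, true_and, false_or]
    rw [hmod x hx]
    constructor
    · rintro ⟨τ, hτ, hs, hp⟩
      exact (hs.sign (hE' x)).2 hp
    · intro hp
      obtain ⟨τ, hτ, hs⟩ := exists_test E x (ξ x)
      exact ⟨τ, hτ, hs, (hs.sign (hE' x)).1 hp⟩
  · simp [hx, h0 x hx]

theorem cover_monic {f : R[X]} (hf : f.Monic) (hd : 0 < f.natDegree)
    (IH : ∀ q : R[X], q.natDegree < f.natDegree → ∃ E, Cover R q E) : ∃ E, Cover R f E := by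
  obtain ⟨C0, hC0, hC0'⟩ := IH f.derivative (natDegree_derivative_lt hd.ne')
  have hmon : ∀ x, (f.map (evR R x)).Monic := fun x => hf.map _
  have hdeg : ∀ x, (f.map (evR R x)).natDegree = f.natDegree := fun x => hf.natDegree_map _
  have hder : ∀ x, (f.derivative.map (evR R x)) ≠ 0 := by
    intro x hx
    rw [← derivative_map] at hx
    have := derivative_eq_zero.1 hx
    rw [hdeg] at this; omega
  set M : (ι → ℝ) → ℝ :=
    1 + ∑ i ∈ Finset.range f.natDegree, (1 + (f.coeff i : (ι → ℝ) → ℝ) ^ 2) with hM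
  have hMR : M ∈ R := R.add_mem R.one_mem (R.sum_mem fun i _ =>
    R.add_mem R.one_mem (R.pow_mem (f.coeff i).2 2))
  have hbound : ∀ x y, (f.map (evR R x)).eval y = 0 → |y| ≤ M x := by
    intro x y hy
    have h1 := IsRoot.norm_lt_cauchyBound (hmon x).ne_zero hy
    have h2 : cauchyBound (f.map (evR R x)) ≤
        (∑ i ∈ Finset.range f.natDegree, ‖(f.map (evR R x)).coeff i‖₊) + 1 := by
      rw [cauchyBound, hdeg, (hmon x).leadingCoeff]
      simp only [nnnorm_one, div_one]
      gcongr
      exact Finset.sup_le fun i hi => Finset.single_le_sum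
        (f := fun i => ‖(f.map (evR R x)).coeff i‖₊) (fun _ _ => zero_le) hi
    have h3 : |y| ≤ (∑ i ∈ Finset.range f.natDegree, ‖(f.map (evR R x)).coeff i‖) + 1 := by
      have := (h1.trans_le h2).le
      have := NNReal.coe_le_coe.2 this
      simpa using this
    refine h3.trans ?_
    rw [hM, add_comm]
    simp only [Pi.add_apply, Pi.one_apply, Finset.sum_apply, Pi.pow_apply, coeff_map, evR_apply]
    gcongr with i hi
    rw [Real.norm_eq_abs]
    nlinarith [abs_nonneg ((f.coeff i : (ι → ℝ) → ℝ) x), sq_abs ((f.coeff i : (ι → ℝ) → ℝ) x),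
      sq_nonneg (|(f.coeff i : (ι → ℝ) → ℝ) x| - 1)]
  set Cs : List ((ι → ℝ) → ℝ) := M :: (-M) :: C0 with hCs
  have hC : ∀ c ∈ Cs, c ∈ R := by
    intro c hc
    simp only [hCs, List.mem_cons] at hc
    rcases hc with rfl | rfl | h
    · exact hMR
    · exact R.neg_mem hMR
    · exact hC0 c h
  let Q : ((ι → ℝ) → ℝ) → ((ι → ℝ) → ℝ) → (ι → ℝ) → Prop := fun a b x =>
    a x ≤ b x ∧ (∀ c ∈ Cs, ¬ (a x < c x ∧ c x < b x)) ∧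
      (f.map (evR R x)).eval (a x) * (f.map (evR R x)).eval (b x) ≤ 0
  have hQ : ∀ a ∈ Cs, ∀ b ∈ Cs, Df (Q a b) := by
    intro a ha b hb
    exact (hR.le (hC a ha) (hC b hb)).and ((Df.allMem Cs fun c hc =>
      ((hR.lt (hC a ha) (hC c hc)).and (hR.lt (hC c hc) (hC b hb))).not).and
      (hR.le (R.mul_mem (eval_mem f (hC a ha)) (eval_mem f (hC b hb))) (const 0)))
  have hinj : ∀ (a b : (ι → ℝ) → ℝ) (x : ι → ℝ), (∀ c ∈ Cs, ¬ (a x < c x ∧ c x < b x)) →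
      Set.InjOn (fun y => (f.map (evR R x)).eval y) (Set.Icc (a x) (b x)) := by
    intro a b x h
    apply injOn_of_deriv
    intro z hz1 hz2 hz0
    rw [derivative_map] at hz0
    obtain ⟨e, he, rfl⟩ := hC0' x (hder x) z hz0
    exact h e (by simp [hCs, he]) ⟨hz1, hz2⟩
  have hex : ∀ (a b : (ι → ℝ) → ℝ) (x : ι → ℝ), ∃ y, (Q a b x → y ∈ Set.Icc (a x) (b x) ∧ (f.map (evR R x)).eval y = 0) ∧
      (¬ Q a b x → y = 0) := by
    intro a b x
    by_cases h : Q a b x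
    · obtain ⟨y, hy⟩ := exists_root_Icc h.1 h.2.2
      exact ⟨y, fun _ => hy, fun h' => absurd h h'⟩
    · exact ⟨0, fun h' => absurd h' h, fun _ => rfl⟩
  choose ξ hξ hξ0 using hex
  have heq : ∀ a ∈ Cs, ∀ b ∈ Cs, ∀ e ∈ R, Df (fun x => Q a b x ∧ ξ a b x = e x) := by
    intro a ha b hb e he
    refine ((hQ a ha b hb).and (((hR.le (hC a ha) he).and (hR.le he (hC b hb))).and
      (hR.eq (eval_mem f he) (const 0)))).congr fun x => and_congr_right fun hq => ?_
    have h1 := hξ a b x hq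
    constructor
    · rintro ⟨h2, h3⟩
      exact hinj a b x hq.2.1 h1.1 h2 (h1.2.trans h3.symm)
    · intro h; rw [← h]; exact h1
  have hle : ∀ a ∈ Cs, ∀ b ∈ Cs, ∀ e ∈ R, Df (fun x => Q a b x ∧ ξ a b x ≤ e x) := by
    intro a ha b hb e he
    refine ((hQ a ha b hb).and ((hR.lt (hC b hb) he).or (((hR.le (hC a ha) he).and 
      (hR.le he (hC b hb))).and
      (hR.le (R.mul_mem (eval_mem f (hC a ha)) (eval_mem f he)) (const 0))))).congr
      fun x => and_congr_right fun hq => ?_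
    have h1 := hξ a b x hq
    have hi := hinj a b x hq.2.1
    constructor
    · rintro (h2 | ⟨⟨h2, h3⟩, h4⟩)
      · exact h1.1.2.trans h2.le
      · obtain ⟨y, hy, hy0⟩ := exists_root_Icc h2 h4
        have : ξ a b x = y := hi h1.1 ⟨hy.1, hy.2.trans h3⟩ (h1.2.trans hy0.symm)
        rw [this]; exact hy.2
    · intro h
      by_cases h2 : b x < e x
      · exact Or.inl h2
      · push Not at h2
        exact Or.inr ⟨⟨h1.1.1.trans h, h2⟩, neg_mul_of_injOn
          (hi.mono (Set.Icc_subset_Icc_right h2)) ⟨h1.1.1, h⟩ h1.2⟩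
  refine ⟨Cs.flatMap fun a => Cs.map fun b => ξ a b, ?_, ?_⟩
  · intro e he
    simp only [List.mem_flatMap, List.mem_map] at he
    obtain ⟨a, ha, b, hb, rfl⟩ := he
    exact hR.root_mem hf hd IH (Q a b) (hQ a ha b hb) _ (hξ0 a b) (fun x hx => (hξ a b x hx).2)
      (hle a ha b hb) (heq a ha b hb)
  · intro x _ y hy
    have hb := abs_le.1 (hbound x y hy)
    rcases exists_max_list Cs x (· ≤ y) with h | ⟨a, ha, hay, ham⟩
    · exact absurd hb.1 (h (-M) (by simp [hCs]))
    rcases exists_min_list Cs x (y ≤ ·) with h | ⟨b, hb, hby, hbm⟩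
    · exact absurd hb.2 (h M (by simp [hCs]))
    have hno : ∀ c ∈ Cs, ¬ (a x < c x ∧ c x < b x) := by
      rintro c hc ⟨h1, h2⟩
      rcases le_total (c x) y with h | h
      · exact absurd (ham c hc h) (not_le.2 h1)
      · exact absurd (hbm c hc h) (not_le.2 h2)
    have hq : Q a b x := ⟨hay.trans hby, hno, neg_mul_of_injOn (hinj a b x hno) ⟨hay, hby⟩ hy⟩
    refine ⟨ξ a b, by simp only [List.mem_flatMap, List.mem_map]; exact ⟨a, ha, b, hb, rfl⟩, ?_⟩
    exact hinj a b x hno (hξ a b x hq).1 ⟨hay, hby⟩ ((hξ a b x hq).2.trans hy.symm)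

theorem cover (d : ℕ) : ∀ f : R[X], f.natDegree < d → ∃ E, Cover R f E := by
  induction d with
  | zero => intro f h; omega
  | succ d IH =>
    intro f hfd
    rcases Nat.eq_zero_or_pos f.natDegree with h0 | hpos
    · refine ⟨[], by simp, fun x hx y hy => ?_⟩
      rw [natDegree_eq_zero] at h0
      obtain ⟨a, rfl⟩ := h0
      simp only [map_C, eval_C] at hy
      simp [hy] at hx
    · set a : R := f.leadingCoeff with ha
      let ia : R := ⟨_, hR.inv_mem a.2⟩
      let m : R[X] := X ^ f.natDegree + C ia * f.eraseLead
      have hdl : (C ia * f.eraseLead).degree < f.natDegree := by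
        rw [← smul_eq_C_mul]
        refine (degree_smul_le _ _).trans_lt ?_
        have : f ≠ 0 := by rintro rfl; simp at hpos
        rw [← degree_eq_natDegree this]
        exact degree_eraseLead_lt this
      have hm : m.Monic := monic_X_pow_add hdl
      have hmd : m.natDegree = f.natDegree := by
        have : Nontrivial R := inferInstance
        exact natDegree_eq_of_degree_eq_some (by
          rw [show m = _ from rfl, degree_add_eq_left_of_degree_lt (by rwa [degree_X_pow]), degree_X_pow])
      obtain ⟨E1, hE1, hE1'⟩ := hR.cover_monic hm (hmd ▸ hpos) fun q hq => IH q (by omega)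
      obtain ⟨E2, hE2, hE2'⟩ := IH f.eraseLead (by
        have := f.eraseLead_natDegree_le; omega)
      refine ⟨E1 ++ E2, ?_, ?_⟩
      · intro e he
        rcases List.mem_append.1 he with h | h
        exacts [hE1 e h, hE2 e h]
      · intro x hx y hy
        have hdec : f.map (evR R x) = (f.eraseLead).map (evR R x) +
            C ((a : (ι → ℝ) → ℝ) x) * X ^ f.natDegree := by
          have := congrArg (Polynomial.map (evR R x)) (eraseLead_add_C_mul_X_pow f)
          rw [← this]
          simp only [Polynomial.map_add, Polynomial.map_pow, map_X, Polynomial.map_mul, map_C]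
          rfl
        by_cases hax : (a : (ι → ℝ) → ℝ) x = 0
        · rw [hax] at hdec
          simp only [map_zero, zero_mul, add_zero] at hdec
          rw [hdec] at hx hy
          obtain ⟨e, he, h⟩ := hE2' x hx y hy
          exact ⟨e, by simp [he], h⟩
        · obtain ⟨e, he, h⟩ := hE1' x (hm.map _).ne_zero y (by
            rw [hdec] at hy
            simp only [eval_add, eval_mul, eval_C, eval_pow, eval_X] at hy
            have : evR R x ia = ((a : (ι → ℝ) → ℝ) x)⁻¹ := rfl
            simp only [m, Polynomial.map_add, Polynomial.map_pow, map_X, Polynomial.map_mul, map_C,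
              eval_add, eval_mul, eval_C, eval_pow, eval_X, this]
            field_simp
            linarith)
          exact ⟨e, by simp [he], h⟩

end MaxR

def pt {κ : Type} (t : ℝ) (x : κ → ℝ) : Option κ → ℝ := fun o => o.elim t x

theorem pt_eta {κ : Type} (z : Option κ → ℝ) : pt (z none) (fun i => z (some i)) = z := by
  funext o; cases o <;> rfl

theorem poly_lift {R : Alg ι} (hR : MaxR R) (P : MvPolynomial (Option ι) ℝ) :
    ∃ p : R[X], ∀ x y, (p.map (evR R x)).eval y = MvPolynomial.eval (pt y x) P := by
  induction P using MvPolynomial.induction_on with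
  | C a => exact ⟨C ⟨_, MaxR.const a⟩, fun x y => by simp⟩
  | add p q hp hq =>
    obtain ⟨p', hp⟩ := hp
    obtain ⟨q', hq⟩ := hq
    exact ⟨p' + q', fun x y => by simp [hp, hq]⟩
  | mul_X p i hp =>
    obtain ⟨p', hp⟩ := hp
    cases i with
    | none => exact ⟨p' * X, fun x y => by simp [hp, pt]⟩
    | some i =>
      have : (fun x : ι → ℝ => x i) ∈ R := hR.poly ⟨MvPolynomial.X i, by simp⟩
      exact ⟨p' * C ⟨_, this⟩, fun x y => by simp [hp, pt]⟩

theorem tarski {S : Set (Option ι → ℝ)} (h : IsRSA (Option ι) S) :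
    Df (fun x : ι → ℝ => ∃ y, pt y x ∈ S) := by
  obtain ⟨R, hR⟩ := exists_maxR (ι := ι)
  have key : ∃ E : List ((ι → ℝ) → ℝ), (∀ e ∈ E, e ∈ R) ∧
      (∀ x y τ, MaxR.SamePos E x y τ → (pt y x ∈ S ↔ pt τ x ∈ S)) ∧
      ∀ r ∈ R, Df (fun x => pt (r x) x ∈ S) := by
    induction h with
    | basic P =>
      obtain ⟨p, hp⟩ := poly_lift hR P
      obtain ⟨E, hE, hE'⟩ := hR.cover _ p (Nat.lt_succ_self _)
      refine ⟨E, hE, fun x y τ h => ?_, fun r hr => ?_⟩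
      · have := h.sign (hE' x)
        rw [hp, hp] at this
        exact this
      · refine (hR.pos (MaxR.eval_mem p hr)).congr fun x => ?_
        rw [hp]; rfl
    | compl _ ih =>
      obtain ⟨E, h1, h2, h3⟩ := ih
      exact ⟨E, h1, fun x y τ h => not_congr (h2 x y τ h), fun r hr => (h3 r hr).not⟩
    | union _ _ ih ih' =>
      obtain ⟨E, h1, h2, h3⟩ := ih
      obtain ⟨E', h1', h2', h3'⟩ := ih'
      refine ⟨E ++ E', ?_, fun x y τ h => or_congr (h2 x y τ fun e he => h e (by simp [he])) 
        (h2' x y τ fun e he => h e (by simp [he])), fun r hr => (h3 r hr).or (h3' r hr)⟩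
      intro e he
      rcases List.mem_append.1 he with h | h
      exacts [h1 e h, h1' e h]
  obtain ⟨E, h1, h2, h3⟩ := key
  refine (Df.exMem (MaxR.tests E) (P := fun τ x => pt (τ x) x ∈ S) fun τ hτ =>
    h3 τ (MaxR.tests_mem h1 τ hτ)).congr fun x => ?_
  constructor
  · rintro ⟨τ, _, h⟩; exact ⟨_, h⟩
  · rintro ⟨y, hy⟩
    obtain ⟨τ, hτ, hs⟩ := MaxR.exists_test E x y
    exact ⟨τ, hτ, (h2 x _ _ hs).1 hy⟩

end TS
section FO
variable {ι κ : Type}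

def Po (φ : (ι → ℝ) → ℝ) : Prop := ∃ p : MvPolynomial ι ℝ, ∀ x, φ x = MvPolynomial.eval x p

theorem Po.coord (i : ι) : Po (fun x => x i) := ⟨MvPolynomial.X i, fun x => by simp⟩
theorem Po.const (c : ℝ) : Po (fun _ : ι → ℝ => c) := ⟨MvPolynomial.C c, fun x => by simp⟩
theorem Po.add {φ ψ : (ι → ℝ) → ℝ} (h : Po φ) (h' : Po ψ) : Po (fun x => φ x + ψ x) := by
  obtain ⟨p, hp⟩ := h
  obtain ⟨q, hq⟩ := h'
  exact ⟨p + q, fun x => by simp [hp, hq]⟩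
theorem Po.sub {φ ψ : (ι → ℝ) → ℝ} (h : Po φ) (h' : Po ψ) : Po (fun x => φ x - ψ x) := by
  obtain ⟨p, hp⟩ := h
  obtain ⟨q, hq⟩ := h'
  exact ⟨p - q, fun x => by simp [hp, hq]⟩
theorem Po.sq {φ : (ι → ℝ) → ℝ} (h : Po φ) : Po (fun x => φ x ^ 2) := by
  obtain ⟨p, hp⟩ := h
  exact ⟨p ^ 2, fun x => by simp [hp]⟩
theorem Po.sum {α : Type} (s : Finset α) {φ : α → (ι → ℝ) → ℝ} (h : ∀ a, Po (φ a)) :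
    Po (fun x => ∑ a ∈ s, φ a x) := by
  choose p hp using h
  exact ⟨∑ a ∈ s, p a, fun x => by simp [hp]⟩
theorem Df.lt {φ ψ : (ι → ℝ) → ℝ} (h : Po φ) (h' : Po ψ) : Df (fun x => φ x < ψ x) := by
  obtain ⟨p, hp⟩ := h'.sub h
  exact (show Df _ from IsRSA.basic p).congr fun x => by rw [← hp]; simp
theorem Df.le {φ ψ : (ι → ℝ) → ℝ} (h : Po φ) (h' : Po ψ) : Df (fun x => φ x ≤ ψ x) :=
  (Df.lt h' h).not.congr fun x => by simp
theorem Df.eq {φ ψ : (ι → ℝ) → ℝ} (h : Po φ) (h' : Po ψ) : Df (fun x => φ x = ψ x) :=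
  ((Df.le h h').and (Df.le h' h)).congr fun x => by simp [le_antisymm_iff]

theorem Df.subst {S : Set (κ → ℝ)} (h : IsRSA κ S) {φ : (ι → ℝ) → κ → ℝ}
    (hφ : ∀ k, Po (fun x => φ x k)) : Df (fun x => φ x ∈ S) := by
  induction h with
  | basic P =>
    choose p hp using hφ
    refine (show Df _ from IsRSA.basic (MvPolynomial.bind₁ p P)).congr fun x => ?_
    have : MvPolynomial.eval x (MvPolynomial.bind₁ p P) = MvPolynomial.eval (φ x) P := by
      have h2 : φ x = fun k => MvPolynomial.eval x (p k) := funext fun k => hp k x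
      rw [h2]
      induction P using MvPolynomial.induction_on with
      | C a => simp
      | add p q hp hq => simp [hp, hq]
      | mul_X p i hp => simp [hp]
    rw [this]; rfl
  | compl _ ih => exact ih.not
  | union _ _ ih ih' => exact ih.or ih'

theorem Df.sub {P : (κ → ℝ) → Prop} (h : Df P) {φ : (ι → ℝ) → κ → ℝ}
    (hφ : ∀ k, Po (fun x => φ x k)) : Df (fun x => P (φ x)) := Df.subst (S := {x | P x}) h hφ

theorem Df.ex {Q : (ι → ℝ) → ℝ → Prop}
    (h : Df (fun z : Option ι → ℝ => Q (fun i => z (some i)) (z none))) : Df (fun x => ∃ y, Q x y) :=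
  (tarski h).congr fun _ => Iff.rfl

theorem Df.all {Q : (ι → ℝ) → ℝ → Prop}
    (h : Df (fun z : Option ι → ℝ => Q (fun i => z (some i)) (z none))) : Df (fun x => ∀ y, Q x y) :=
  (Df.ex (Q := fun x y => ¬ Q x y) h.not).not.congr fun x => by simp

theorem Df.exV_aux (κ : Type) [Finite κ] : ∀ (ι : Type) (Q : (ι → ℝ) → (κ → ℝ) → Prop),
    Df (fun z : ι ⊕ κ → ℝ => Q (fun i => z (Sum.inl i)) (fun i => z (Sum.inr i))) →
    Df (fun x => ∃ y, Q x y) := by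
  induction κ using Finite.induction_empty_option with
  | of_equiv e ih =>
    intro ι Q h
    refine (ih ι (fun x y => Q x (fun k => y (e.symm k))) ?_).congr fun x => ?_
    · exact (h.sub (φ := fun z => Sum.elim (fun i => z (Sum.inl i)) fun k => z (Sum.inr (e.symm k)))
        (by rintro (i | k) <;> exact Po.coord _))
    · constructor
      · rintro ⟨y, hy⟩; exact ⟨_, hy⟩
      · rintro ⟨y, hy⟩; exact ⟨fun k => y (e k), by simpa using hy⟩
  | h_empty =>
    intro ι Q h
    refine (h.sub (φ := fun z => Sum.elim z PEmpty.elim) (by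
      rintro (i | k)
      · exact Po.coord _
      · exact k.elim)).congr fun x => ?_
    constructor
    · intro h; exact ⟨_, h⟩
    · rintro ⟨y, hy⟩
      have : (fun i => Sum.elim x PEmpty.elim (Sum.inr i)) = y := funext fun i => i.elim
      rw [← this] at hy
      exact hy
  | h_option ih =>
    intro ι Q h
    refine (ih ι (fun x y => ∃ t, Q x (pt t y)) ?_).congr fun x => ?_
    · apply Df.ex
      refine (h.sub (φ := fun z => Sum.elim (fun i => z (some (Sum.inl i)))
        fun k => pt (z none) (fun i => z (some (Sum.inr i))) k) ?_)
      rintro (i | (_ | k)) <;> exact Po.coord _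
    · constructor
      · rintro ⟨y, t, hy⟩; exact ⟨_, hy⟩
      · rintro ⟨y, hy⟩; exact ⟨fun i => y (some i), y none, by rw [pt_eta]; exact hy⟩

theorem Df.exV [Finite κ] {Q : (ι → ℝ) → (κ → ℝ) → Prop}
    (h : Df (fun z : ι ⊕ κ → ℝ => Q (fun i => z (Sum.inl i)) (fun i => z (Sum.inr i)))) :
    Df (fun x => ∃ y, Q x y) := Df.exV_aux κ ι Q h

theorem Df.allV [Finite κ] {Q : (ι → ℝ) → (κ → ℝ) → Prop}
    (h : Df (fun z : ι ⊕ κ → ℝ => Q (fun i => z (Sum.inl i)) (fun i => z (Sum.inr i)))) :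
    Df (fun x => ∀ y, Q x y) :=
  (Df.exV (Q := fun x y => ¬ Q x y) h.not).not.congr fun x => by simp

/-! one variable -/

theorem finite_frontier {S : Set (Unit → ℝ)} (h : IsRSA Unit S) :
    (frontier {t : ℝ | (fun _ => t) ∈ S}).Finite := by
  induction h with
  | basic P =>
    let p : Polynomial ℝ := MvPolynomial.aeval (fun _ => Polynomial.X) P
    have hp : ∀ t : ℝ, MvPolynomial.eval (fun _ => t) P = p.eval t := by
      intro t
      simp only [p]
      induction P using MvPolynomial.induction_on with
      | C a => simp
      | add p q hp hq => simp [hp, hq]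
      | mul_X p i hp => simp [hp]
    simp only [Set.mem_ofPred_eq, hp]
    by_cases h0 : p = 0
    · simp [h0]
    · refine (p.roots.toFinset.finite_toSet).subset ?_
      intro t ht
      have := frontier_lt_subset_eq continuous_const p.continuous ht
      simp only [Finset.mem_coe, Multiset.mem_toFinset, Polynomial.mem_roots h0]
      exact this.symm
  | compl _ ih =>
    rw [← frontier_compl] at ih
    exact ih
  | union _ _ ih ih' =>
    refine (ih.union ih').subset ((frontier_union_subset _ _).trans ?_)
    exact Set.union_subset_union Set.inter_subset_left Set.inter_subset_right

theorem ev_or {P : ℝ → Prop} (h : Df (fun u : Unit → ℝ => P (u ()))) :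
    (∀ᶠ t in 𝓝[>] (0:ℝ), P t) ∨ (∀ᶠ t in 𝓝[>] (0:ℝ), ¬ P t) := by
  have hF : (frontier {t | P t}).Finite := finite_frontier h
  have h1 : ∀ᶠ t in 𝓝[>] (0:ℝ), t ∉ frontier {t | P t} := by
    have h2 : ∀ᶠ t in 𝓝 (0:ℝ), t ∉ frontier {t | P t} \ {0} :=
      (hF.subset Set.sdiff_subset).isClosed.isOpen_compl.mem_nhds (by simp)
    filter_upwards [nhdsWithin_le_nhds h2, self_mem_nhdsWithin] with t ht h0 hc
    exact ht ⟨hc, ne_of_gt h0⟩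
  obtain ⟨δ, hδ, hsub⟩ := mem_nhdsGT_iff_exists_Ioo_subset.1 h1
  have hmem : Set.Ioo 0 δ ∈ 𝓝[>] (0:ℝ) := Ioo_mem_nhdsGT hδ
  by_cases hc : ∃ t ∈ Set.Ioo 0 δ, P t
  · left
    obtain ⟨t0, ht0, hP⟩ := hc
    filter_upwards [hmem] with t ht
    by_contra hn
    have hI : ∀ z ∈ Set.Ioo 0 δ, ∀ S : Set ℝ, z ∈ S → z ∉ frontier S → z ∈ interior S := by
      intro z _ S h1 h2
      by_contra h3
      exact h2 ⟨subset_closure h1, h3⟩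
    have hI1 : ∀ z ∈ Set.Ioo 0 δ, P z → z ∈ interior {t | P t} := fun z hz hp =>
      hI z hz _ hp (hsub hz)
    have hI2 : ∀ z ∈ Set.Ioo 0 δ, ¬ P z → z ∈ interior {t | P t}ᶜ := fun z hz hp =>
      hI z hz _ hp (by rw [frontier_compl]; exact hsub hz)
    obtain ⟨z, hz, hz1, hz2⟩ := isPreconnected_Ioo (interior {t | P t}) (interior {t | P t}ᶜ)
      isOpen_interior isOpen_interior (fun z hz => by
        by_cases hp : P z
        · exact Or.inl (hI1 z hz hp)
        · exact Or.inr (hI2 z hz hp)) ⟨t0, ht0, hI1 t0 ht0 hP⟩ ⟨t, ht, hI2 t ht hn⟩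
    exact interior_subset hz2 (interior_subset hz1)
  · right
    push Not at hc
    filter_upwards [hmem] with t ht using hc t ht

theorem ev_cont {h : ℝ → ℝ} {G : ℝ → ℝ → Prop}
    (hG : Df (fun z : Bool → ℝ => G (z true) (z false))) {ε : ℝ} (hε : 0 < ε)
    (hh : ∀ t y, G t y ↔ t ∈ Set.Ioo 0 ε ∧ y = h t) : ∀ᶠ t in 𝓝[>] (0:ℝ), ContinuousAt h t := by
  let Cp : ℝ → Prop := fun t => ∃ y, G t y ∧ ∀ e, 0 < e → ∃ δ, 0 < δ ∧ ∀ s, ∀ w,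
    (s - t) ^ 2 < δ → G s w → (w - y) ^ 2 < e
  have hC : Df (fun u : Unit → ℝ => Cp (u ())) := by
    refine Df.ex (Df.and ?_ (Df.all (Df.imp (Df.lt (Po.const _) (Po.coord _)) (Df.ex (Df.and
      (Df.lt (Po.const _) (Po.coord _)) (Df.all (Df.all (Df.imp (Df.lt (((Po.coord _).sub
      (Po.coord _)).sq) (Po.coord _)) (Df.imp ?_ (Df.lt (((Po.coord _).sub
      (Po.coord _)).sq) (Po.coord _)))))))))))
    · exact hG.sub (φ := fun z b => if b then z (some ()) else z none) (by
        rintro (_ | _) <;> exact Po.coord _)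
    · exact hG.sub (φ := fun z b => if b then z (some none) else z none) (by
        rintro (_ | _) <;> exact Po.coord _)
  have hsq : ∀ a b : ℝ, 0 < b → (a ^ 2 < b ^ 2 ↔ |a| < b) := fun a b hb => by
    rw [sq_lt_sq, abs_of_pos hb]
  rcases ev_or hC with hev | hev
  · filter_upwards [hev, Ioo_mem_nhdsGT hε] with t ht hte
    obtain ⟨y, hy, H⟩ := ht
    obtain rfl := ((hh t y).1 hy).2
    rw [Metric.continuousAt_iff]
    intro e he
    obtain ⟨δ, hδ, H⟩ := H (e ^ 2) (by positivity)
    obtain ⟨η, hη, hη'⟩ := Metric.mem_nhds_iff.1 (Ioo_mem_nhds hte.1 hte.2)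
    refine ⟨min η (Real.sqrt δ), lt_min hη (Real.sqrt_pos.2 hδ), fun {s} hs => ?_⟩
    rw [Real.dist_eq] at *
    have := H s (h s) (by
      rw [← Real.sq_sqrt hδ.le, hsq _ _ (Real.sqrt_pos.2 hδ)]
      exact hs.trans_le (min_le_right _ _)) ((hh _ _).2 ⟨hη' (by
        rw [Metric.mem_ball, Real.dist_eq]; exact hs.trans_le (min_le_left _ _)), rfl⟩)
    rwa [hsq _ _ he] at this
  · exfalso
    obtain ⟨δ, hδ, hsub⟩ := mem_nhdsGT_iff_exists_Ioo_subset.1 hev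
    let A : ℚ → Set ℝ := fun c => {t | ∃ y, G t y ∧ (c:ℝ) < y}
    let B : ℚ → Set ℝ := fun c => {t | ∃ y, G t y ∧ y < (c:ℝ)}
    have hA : ∀ c, (frontier (A c)).Finite := fun c => finite_frontier (S := {u | u () ∈ A c}) <| by
      refine Df.ex (Df.and (hG.sub (φ := fun z b => if b then z (some ()) else z none) (by
        rintro (_ | _) <;> exact Po.coord _)) (Df.lt (Po.const _) (Po.coord _)))
    have hB : ∀ c, (frontier (B c)).Finite := fun c => finite_frontier (S := {u | u () ∈ B c}) <| by
      refine Df.ex (Df.and (hG.sub (φ := fun z b => if b then z (some ()) else z none) (by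
        rintro (_ | _) <;> exact Po.coord _)) (Df.lt (Po.coord _) (Po.const _)))
    have hcount : ((⋃ c, frontier (A c)) ∪ ⋃ c, frontier (B c)).Countable :=
      (Set.countable_iUnion fun c => (hA c).countable).union
        (Set.countable_iUnion fun c => (hB c).countable)
    obtain ⟨t, ht, htn⟩ := (hcount.dense_compl ℝ).exists_mem_open
      (isOpen_Ioo (a := (0:ℝ)) (b := min δ ε)) ⟨min δ ε / 2, by
        have : 0 < min δ ε := lt_min hδ hε
        constructor <;> linarith⟩
    have htd := htn
    simp only [Set.mem_compl_iff, Set.mem_union, Set.mem_iUnion, not_or, not_exists] at ht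
    have hte : t ∈ Set.Ioo 0 ε := ⟨htd.1, htd.2.trans_le (min_le_right _ _)⟩
    have hint : ∀ S : Set ℝ, t ∈ S → t ∉ frontier S → S ∈ 𝓝 t := by
      intro S h1 h2
      rw [← mem_interior_iff_mem_nhds]
      by_contra h3
      exact h2 ⟨subset_closure h1, h3⟩
    have hcont : ContinuousAt h t := by
      refine tendsto_order.2 ⟨fun a ha => ?_, fun a ha => ?_⟩
      · obtain ⟨c, hc1, hc2⟩ := exists_rat_btwn ha
        filter_upwards [hint (A c) ⟨h t, (hh _ _).2 ⟨hte, rfl⟩, hc2⟩ (ht.1 c)] with s hs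
        obtain ⟨y, hy, hcy⟩ := hs
        rw [← ((hh _ _).1 hy).2]; linarith
      · obtain ⟨c, hc1, hc2⟩ := exists_rat_btwn ha
        filter_upwards [hint (B c) ⟨h t, (hh _ _).2 ⟨hte, rfl⟩, hc1⟩ (ht.2 c)] with s hs
        obtain ⟨y, hy, hcy⟩ := hs
        rw [← ((hh _ _).1 hy).2]; linarith
    refine hsub ⟨htd.1, htd.2.trans_le (min_le_left _ _)⟩ ⟨h t, (hh _ _).2 ⟨hte, rfl⟩, fun e he => ?_⟩
    obtain ⟨δ', hδ', H⟩ := Metric.continuousAt_iff.1 hcont (Real.sqrt e) (Real.sqrt_pos.2 he)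
    refine ⟨δ' ^ 2, by positivity, fun s w hs hw => ?_⟩
    rw [((hh _ _).1 hw).2, ← Real.sq_sqrt he.le, hsq _ _ (Real.sqrt_pos.2 he), ← Real.dist_eq]
    apply H
    rwa [Real.dist_eq, ← hsq _ _ hδ']

end FO
section Sel
variable {n : ℕ}

theorem compact_argmin {K : Set (Fin n → ℝ)} (hK : IsCompact K) {φ : (Fin n → ℝ) → ℝ}
    (hφ : ContinuousOn φ K) : IsCompact {x | x ∈ K ∧ ∀ y ∈ K, φ x ≤ φ y} ∧
      (K.Nonempty → ∃ x, x ∈ K ∧ ∀ y ∈ K, φ x ≤ φ y) := by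
  rcases K.eq_empty_or_nonempty with h | h
  · subst h; simp
  obtain ⟨x0, hx0, hm⟩ := hK.exists_isMinOn h hφ
  refine ⟨?_, fun _ => ⟨x0, hx0, fun y hy => hm hy⟩⟩
  have : {x | x ∈ K ∧ ∀ y ∈ K, φ x ≤ φ y} = K ∩ φ ⁻¹' Set.Iic (φ x0) := by
    ext x
    exact ⟨fun h => ⟨h.1, h.2 x0 hx0⟩, fun h => ⟨h.1, fun y hy => le_trans h.2 (hm hy)⟩⟩
  rw [this]
  exact hK.of_isClosed_subset (hφ.preimage_isClosed_of_isClosed hK.isClosed isClosed_Iic)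
    Set.inter_subset_left

/-- definable families -/
def DF (K : ℝ → (Fin n → ℝ) → Prop) : Prop :=
  Df (fun z : Option (Fin n) → ℝ => K (z none) (fun i => z (some i)))

theorem DF.app {K : ℝ → (Fin n → ℝ) → Prop} (h : DF K) {ι : Type} {t : (ι → ℝ) → ℝ}
    {x : (ι → ℝ) → Fin n → ℝ} (ht : Po t) (hx : ∀ i, Po (fun z => x z i)) :
    Df (fun z => K (t z) (x z)) :=
  h.sub (φ := fun z => pt (t z) (x z)) (by rintro (_ | i); exacts [ht, hx i])

theorem lexsel (L : List (Fin n)) : ∀ {K : ℝ → (Fin n → ℝ) → Prop}, DF K →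
    (∀ t, IsCompact {x | K t x}) → ∃ K' : ℝ → (Fin n → ℝ) → Prop, DF K' ∧
      (∀ t x, K' t x → K t x) ∧ (∀ t, (∃ x, K t x) → ∃ x, K' t x) ∧
      ∀ i ∈ L, ∀ t x y, K' t x → K' t y → x i = y i := by
  induction L with
  | nil => intro K h1 h2; exact ⟨K, h1, fun _ _ h => h, fun _ h => h, by simp⟩
  | cons i L ih =>
    intro K h1 h2
    let K1 : ℝ → (Fin n → ℝ) → Prop := fun t x => K t x ∧ ∀ y, K t y → x i ≤ y i
    have hc := fun t => compact_argmin (h2 t) (φ := fun x => x i) (continuous_apply i).continuousOn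
    obtain ⟨K', a1, a2, a3, a4⟩ := ih (K := K1) (by
      refine Df.and h1 (Df.allV (Df.imp ?_ (Df.le (Po.coord _) (Po.coord _))))
      exact h1.app (Po.coord _) (fun _ => Po.coord _)) (fun t => (hc t).1)
    refine ⟨K', a1, fun t x h => (a2 t x h).1, fun t h => a3 t ((hc t).2 h), ?_⟩
    intro j hj t x y hx hy
    rcases List.mem_cons.1 hj with rfl | hj
    · exact le_antisymm ((a2 t x hx).2 y (a2 t y hy).1) ((a2 t y hy).2 x (a2 t x hx).1)
    · exact a4 j hj t x y hx hy

theorem main_half (f g : (Fin n → ℝ) → ℝ) (U : Set (Fin n → ℝ))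
    (hU : U ∈ nhds (0 : Fin n → ℝ))
    (hfC : ContinuousOn f U) (hgC : ContinuousOn g U)
    (hfSA : IsRSA (Option (Fin n)) (graphFunOn f U))
    (hgSA : IsRSA (Option (Fin n)) (graphFunOn g U))
    (hf0 : f 0 = 0) 
    (harc : ArcFib f ⊆ ArcFib g) :
    ∃ r > (0 : ℝ), ∀ x : Fin n → ℝ, ∑ i, x i ^ 2 ≤ r → 0 < f x → g x = f x := by
  by_contra hcon
  push Not at hcon
  let q : (Fin n → ℝ) → ℝ := fun x => ∑ i, x i ^ 2
  have hqc : Continuous q := by fun_prop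
  have hq0 : ∀ x, 0 ≤ q x := fun x => Finset.sum_nonneg fun i _ => sq_nonneg _
  have hqi : ∀ x i, x i ^ 2 ≤ q x := fun x i =>
    Finset.single_le_sum (f := fun i => x i ^ 2) (fun i _ => sq_nonneg _) (Finset.mem_univ i)
  have hqn : ∀ x e, 0 < e → q x < e ^ 2 → ‖x‖ < e := by
    intro x e he h
    rw [pi_norm_lt_iff he]
    intro i
    exact abs_lt_of_sq_lt_sq ((hqi x i).trans_lt h) he.le
  have hqP : ∀ {ι : Type} {x : (ι → ℝ) → Fin n → ℝ}, (∀ i, Po (fun z => x z i)) →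
      Po (fun z => q (x z)) := fun h => Po.sum _ fun i => (h i).sq
  obtain ⟨ε0, hε0, hball⟩ := Metric.mem_nhds_iff.1 hU
  let ρ : ℝ := (ε0 / 2) ^ 2
  have hρ : 0 < ρ := by positivity
  have hBU : ∀ x, q x ≤ ρ → x ∈ U := by
    intro x hx
    refine hball ?_
    rw [mem_ball_zero_iff]
    apply hqn x _ hε0
    have : ρ < ε0 ^ 2 := by simp only [ρ]; nlinarith
    exact hx.trans_lt this
  have hBc : IsCompact {x | q x ≤ ρ} := by
    refine (isCompact_closedBall (0 : Fin n → ℝ) ε0).of_isClosed_subset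
      (isClosed_le hqc continuous_const) fun x hx => ?_
    rw [mem_closedBall_zero_iff]
    refine (hqn x _ hε0 ?_).le
    have : ρ < ε0 ^ 2 := by simp only [ρ]; nlinarith
    exact lt_of_le_of_lt hx this
  let T : ℝ → (Fin n → ℝ) → Prop := fun t x => q x ≤ ρ ∧ 0 < t ∧ f x = t ∧ g x ≠ t
  let F0 : ℝ → (Fin n → ℝ) → Prop := fun t x => q x ≤ ρ ∧ 0 < t ∧ f x = t
  let GG : ℝ → (Fin n → ℝ) → Prop := fun t x => q x ≤ ρ ∧ t = g x
  have hGG : DF GG := by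
    refine ((Df.le (hqP fun _ => Po.coord _) (Po.const ρ)).and (show Df _ from hgSA)).congr
      fun z => and_congr_right fun h => ?_
    exact ⟨fun h' => h'.2, fun h' => ⟨hBU _ h, h'⟩⟩
  have hF0 : DF F0 := by
    refine ((Df.le (hqP fun _ => Po.coord _) (Po.const ρ)).and
      ((Df.lt (Po.const 0) (Po.coord none)).and (show Df _ from hfSA))).congr
      fun z => and_congr_right fun h => and_congr_right fun _ => ?_
    exact ⟨fun h' => h'.2.symm, fun h' => ⟨hBU _ h, h'.symm⟩⟩
  have hT : DF T := by
    refine (Df.and hF0 hGG.not).congr fun z => ?_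
    simp only [T, F0, GG]
    constructor
    · rintro ⟨⟨a, b, c⟩, d⟩; exact ⟨a, b, c, fun h => d ⟨a, h.symm⟩⟩
    · rintro ⟨a, b, c, d⟩; exact ⟨⟨a, b, c⟩, fun h => d h.2.symm⟩
  -- existence of small points
  have H1 : ∀ s > 0, ∀ᶠ t in 𝓝[>] (0:ℝ), ∃ x, T t x ∧ q x < s := by
    intro s hs
    rcases ev_or (P := fun t => ∃ x, T t x ∧ q x < s) (Df.exV ((hT.app (Po.coord _)
      (fun _ => Po.coord _)).and (Df.lt (hqP fun _ => Po.coord _) (Po.const s)))) with h | h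
    · exact h
    exfalso
    obtain ⟨δ, hδ, hsub⟩ := mem_nhdsGT_iff_exists_Ioo_subset.1 h
    have hfc : ContinuousAt f 0 := hfC.continuousAt hU
    obtain ⟨η, hη, hf⟩ := Metric.continuousAt_iff.1 hfc δ hδ
    obtain ⟨x, hx, hfx, hgx⟩ := hcon (min ((η / 2) ^ 2) (min (s / 2) ρ)) (by positivity)
    have hx1 : q x ≤ (η / 2) ^ 2 := hx.trans (min_le_left _ _)
    have hx2 : q x ≤ s / 2 := hx.trans ((min_le_right _ _).trans (min_le_left _ _))
    have hx3 : q x ≤ ρ := hx.trans ((min_le_right _ _).trans (min_le_right _ _))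
    have h1 := @hf x (by
      rw [dist_zero_right]
      exact hqn x _ hη (by nlinarith))
    rw [hf0, Real.dist_eq, sub_zero, abs_of_pos hfx] at h1
    exact hsub ⟨hfx, h1⟩ ⟨x, ⟨hx3, hfx, rfl, hgx⟩, by linarith⟩
  let K0 : ℝ → (Fin n → ℝ) → Prop := fun t x => F0 t x ∧ ∀ y, T t y → q x ≤ q y + t
  have hK0 : DF K0 := by
    refine Df.and hF0 (Df.allV (Df.imp (hT.app (Po.coord _) (fun _ => Po.coord _))
      (Df.le (hqP fun _ => Po.coord _) ((hqP fun _ => Po.coord _).add (Po.coord _)))))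
  have hK0c : ∀ t, IsCompact {x | K0 t x} := by
    intro t
    by_cases ht : 0 < t
    · have : {x | K0 t x} = ({x | q x ≤ ρ} ∩ f ⁻¹' {t}) ∩ ⋂ y, ⋂ (_ : T t y), {x | q x ≤ q y + t} := by
        ext x
        simp only [K0, F0, Set.mem_ofPred_eq, Set.mem_inter_iff, Set.mem_iInter, ht, true_and]
        rfl
      rw [this]
      refine hBc.of_isClosed_subset (IsClosed.inter ?_ ?_)
        (Set.inter_subset_left.trans Set.inter_subset_left)
      · exact (hfC.mono hBU).preimage_isClosed_of_isClosed hBc.isClosed isClosed_singleton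
      · exact isClosed_iInter fun y => isClosed_iInter fun _ => isClosed_le hqc continuous_const
    · have : {x | K0 t x} = ∅ := by
        ext x; simp [K0, F0, ht]
      rw [this]; exact isCompact_empty
  let K1 : ℝ → (Fin n → ℝ) → Prop := fun t x => K0 t x ∧
    ∀ y, K0 t y → -(t - g x) ^ 2 ≤ -(t - g y) ^ 2
  have hK1 : DF K1 := by
    have key : DF (fun t x => K0 t x ∧ ∀ y, K0 t y → ∃ u, ∃ v, GG u x ∧ GG v y ∧
        (t - v) ^ 2 ≤ (t - u) ^ 2) := by
      refine Df.and hK0 (Df.allV (Df.imp (hK0.app (Po.coord _) (fun _ => Po.coord _))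
        (Df.ex (Df.ex (Df.and (hGG.app (Po.coord _) (fun _ => Po.coord _)) (Df.and
          (hGG.app (Po.coord _) (fun _ => Po.coord _))
          (Df.le ((Po.coord _).sub (Po.coord _)).sq ((Po.coord _).sub (Po.coord _)).sq)))))))
    refine key.congr fun z => and_congr_right fun hz => forall_congr' fun y => imp_congr_right fun hy => ?_
    constructor
    · rintro ⟨u, v, ⟨_, rfl⟩, ⟨_, rfl⟩, h⟩; linarith
    · intro h
      exact ⟨_, _, ⟨hz.1.1, rfl⟩, ⟨hy.1.1, rfl⟩, by linarith⟩
  have hK1c := fun t => compact_argmin (hK0c t) (φ := fun x => -(t - g x) ^ 2) (by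
    have : ContinuousOn g {x | K0 t x} := hgC.mono fun x hx => hBU x hx.1.1
    fun_prop)
  have hK0T : ∀ t, (∃ x, T t x) → ∃ x, K0 t x ∧ g x ≠ t := by
    rintro t ⟨x0, hx0⟩
    have ht : 0 < t := hx0.2.1
    have hne : (q '' {x | T t x}).Nonempty := ⟨_, x0, hx0, rfl⟩
    have hbd : BddBelow (q '' {x | T t x}) := ⟨0, by rintro _ ⟨x, _, rfl⟩; exact hq0 x⟩
    obtain ⟨_, ⟨x, hx, rfl⟩, hlt⟩ := exists_lt_of_csInf_lt hne (lt_add_of_pos_right _ ht)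
    refine ⟨x, ⟨⟨hx.1, hx.2.1, hx.2.2.1⟩, fun y hy => ?_⟩, hx.2.2.2⟩
    have := csInf_le hbd ⟨y, hy, rfl⟩
    linarith
  obtain ⟨K2, hK2, hK21, hK2n, hK2u⟩ := lexsel (List.finRange n) hK1 (fun t => (hK1c t).1)
  have huniq : ∀ t x y, K2 t x → K2 t y → x = y := fun t x y hx hy =>
    funext fun i => hK2u i (List.mem_finRange i) t x y hx hy
  have hex : ∀ t, ∃ x, (∃ y, K2 t y) → K2 t x := by
    intro t
    by_cases h : ∃ y, K2 t y
    · obtain ⟨y, hy⟩ := h; exact ⟨y, fun _ => hy⟩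
    · exact ⟨0, fun h' => absurd h' h⟩
  choose γ hγ using hex
  have hTK : ∀ t, (∃ x, T t x) → K2 t (γ t) ∧ g (γ t) ≠ t := by
    intro t h
    obtain ⟨x, hx, hgx⟩ := hK0T t h
    have h2 := hγ t (hK2n t ((hK1c t).2 ⟨x, hx⟩))
    refine ⟨h2, fun hg => ?_⟩
    have h3 := (hK21 _ _ h2).2 x hx
    rw [hg, sub_self] at h3
    have : 0 < (t - g x) ^ 2 := by
      have : t - g x ≠ 0 := sub_ne_zero.2 (Ne.symm hgx)
      positivity
    nlinarith [h3, this]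
  have hevT : ∀ᶠ t in 𝓝[>] (0:ℝ), ∃ x, T t x :=
    (H1 1 one_pos).mono fun t h => h.imp fun x hx => hx.1
  obtain ⟨ε1, hε1, hsub1⟩ := mem_nhdsGT_iff_exists_Ioo_subset.1 hevT
  have hcont : ∀ i, ∀ᶠ t in 𝓝[>] (0:ℝ), ContinuousAt (fun t => γ t i) t := by
    intro i
    refine ev_cont (G := fun t y => (0 < t ∧ t < ε1) ∧ ∃ x, K2 t x ∧ y = x i) (ε := ε1) ?_ hε1 ?_
    · exact Df.and (Df.and (Df.lt (Po.const _) (Po.coord _)) (Df.lt (Po.coord _) (Po.const _)))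
        (Df.exV (Df.and (hK2.app (Po.coord _) (fun _ => Po.coord _))
          (Df.eq (Po.coord _) (Po.coord _))))
    · intro t y
      refine and_congr_right fun ht => ?_
      have h := (hTK t (hsub1 ht)).1
      constructor
      · rintro ⟨x, hx, rfl⟩; rw [huniq t x _ hx h]
      · intro hy; exact ⟨_, h, hy⟩
  have hcont' : ∀ᶠ t in 𝓝[>] (0:ℝ), ContinuousAt γ t := by
    filter_upwards [eventually_all.2 hcont] with t ht using continuousAt_pi.2 ht
  obtain ⟨ε2, hε2, hsub2⟩ := mem_nhdsGT_iff_exists_Ioo_subset.1 (hcont'.and hevT)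
  have hmem : γ ∈ ArcFib f := by
    refine ⟨⟨ε2, hε2, fun t ht => (hsub2 ht).1.continuousWithinAt, ?_⟩, ?_, ?_⟩
    · refine (show Df (fun z : Option (Fin n) → ℝ => z none ∈ Set.Ioo 0 ε2 ∧
        (fun i => z (some i)) = γ (z none)) from ?_)
      refine (Df.and (Df.and (Df.lt (Po.const 0) (Po.coord none))
        (Df.lt (Po.coord none) (Po.const ε2))) hK2).congr fun z => and_congr_right fun hz => ?_
      have h := (hTK _ (hsub2 hz).2).1
      constructor
      · intro h'; exact huniq _ _ _ h' h
      · intro h'; rw [h']; exact h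
    · rw [Metric.tendsto_nhds]
      intro e he
      have h1 : ∀ᶠ t in 𝓝[>] (0:ℝ), t < e ^ 2 / 2 := 
        nhdsWithin_le_nhds (Iio_mem_nhds (by positivity))
      filter_upwards [H1 (e ^ 2 / 2) (by positivity), h1] with t ht ht'
      obtain ⟨x, hx, hqx⟩ := ht
      rw [dist_zero_right]
      apply hqn _ _ he
      have := (hK21 _ _ (hTK t ⟨x, hx⟩).1).1.2 x hx
      linarith
    · filter_upwards [hevT] with t ht
      exact (hK21 _ _ (hTK t ht).1).1.1.2.2
  have hg := (harc hmem).2.2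
  obtain ⟨t, h1, h2⟩ := (hg.and hevT).exists
  exact (hTK t h2).2 h1

end Sel

/-- Lemma `lem-deb`. Let `f` and `g` be continuous semialgebraic
functions on a common neighbourhood `U` of `0` with `f(0) = g(0) = 0`. If
`𝒻_f = 𝒻_g`, then `F_f(r,a) = F_g(r,a)` for `0 < a ≪ r ≪ 1`. -/
theorem statement12 {n : ℕ} (f g : (Fin n → ℝ) → ℝ) (U : Set (Fin n → ℝ))
    (hU : U ∈ nhds (0 : Fin n → ℝ))
    (hfC : ContinuousOn f U) (hgC : ContinuousOn g U)
    (hfSA : IsRSA (Option (Fin n)) (graphFunOn f U))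
    (hgSA : IsRSA (Option (Fin n)) (graphFunOn g U))
    (hf0 : f 0 = 0) (hg0 : g 0 = 0)
    (harc : ArcFib f = ArcFib g) :
    ∃ r₀ > (0 : ℝ), ∀ r ∈ Set.Ioc (0 : ℝ) r₀, ∃ a₀ > (0 : ℝ), ∀ a ∈ Set.Ioc (0 : ℝ) a₀,
      Fib f r a = Fib g r a := by
  obtain ⟨r1, h1, H1⟩ := main_half f g U hU hfC hgC hfSA hgSA hf0 harc.le
  obtain ⟨r2, h2, H2⟩ := main_half g f U hU hgC hfC hgSA hfSA hg0 harc.ge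
  refine ⟨Real.sqrt (min r1 r2), Real.sqrt_pos.2 (lt_min h1 h2), fun r hr => ⟨1, one_pos, fun a ha => ?_⟩⟩
  ext x
  refine and_congr_right fun hx => ?_
  have hq : ∑ i, x i ^ 2 ≤ min r1 r2 :=
    (Real.sqrt_le_sqrt_iff (lt_min h1 h2).le).1 (hx.trans hr.2)
  constructor
  · intro h
    rw [H1 x (hq.trans (min_le_left _ _)) (h ▸ ha.1), h]
  · intro h
    rw [H2 x (hq.trans (min_le_right _ _)) (h ▸ ha.1), h]

end RealMilnor
end
end
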